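/- For every n ≥ 0 and t > 0, R_n(t) = r_{n+1}(t) + r_n(t), where by convention r_0(t) = 0. -/

import Mathlib

open MeasureTheory Polynomial

/-- The singularly perturbed Gaussian weight `w(x,t) = exp(-x^2 - t/x^2)` for `x ≠ 0`,
extended by `0` at `x = 0`. -/
noncomputable def w (t x : ℝ) : ℝ := if x = 0 then 0 else Real.exp (-x ^ 2 - t / x ^ 2)

theorem measurable_w (t : ℝ) : Measurable (w t) := by
  unfold w
  exact Measurable.ite (measurableSet_singleton 0) measurable_const (by fun_prop)

theorem w_neg (t x : ℝ) : w t (-x) = w t x := by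
  simp [w]

theorem w_nonneg (t x : ℝ) : 0 ≤ w t x := by
  unfold w
  split_ifs <;> positivity

/-- The weight absorbs any even inverse power of `x`, leaving a Gaussian. -/
theorem inv_pow_mul_w_le {t : ℝ} (ht : 0 < t) (j : ℕ) (x : ℝ) :
    (x ^ (2 * j))⁻¹ * w t x ≤ (j.factorial / t ^ j) * Real.exp (-1 * x ^ 2) := by
  by_cases hx : x = 0
  · simp only [w, hx, if_true, mul_zero]
    positivity
  have h1 := Real.pow_div_factorial_le_exp (t / x ^ 2) (by positivity) j
  have h2 : w t x = Real.exp (-1 * x ^ 2) * (Real.exp (t / x ^ 2))⁻¹ := by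
    rw [w, if_neg hx, ← Real.exp_neg, ← Real.exp_add]
    ring_nf
  have hx2 : 0 < x ^ 2 := by positivity
  have h3 : (x ^ (2 * j))⁻¹ * (Real.exp (t / x ^ 2))⁻¹ ≤ j.factorial / t ^ j := by
    have hpow : 0 < x ^ (2 * j) := by rw [pow_mul]; positivity
    rw [← mul_inv, inv_le_comm₀ (by positivity) (by positivity), inv_div]
    calc t ^ j / (j.factorial : ℝ) = x ^ (2 * j) * ((t / x ^ 2) ^ j / j.factorial) := by
          rw [pow_mul, div_pow]
          field_simp
      _ ≤ _ := by
          rw [pow_mul]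
          gcongr
  rw [h2]
  calc _ = ((x ^ (2 * j))⁻¹ * (Real.exp (t / x ^ 2))⁻¹) * Real.exp (-1 * x ^ 2) := by ring
    _ ≤ _ := by gcongr

theorem integrable_eval_mul_gaussian (p : ℝ[X]) :
    Integrable fun x : ℝ => p.eval x * Real.exp (-1 * x ^ 2) := by
  induction p using Polynomial.induction_on' with
  | add p q hp hq =>
    simp only [eval_add, add_mul]
    exact hp.add hq
  | monomial n a =>
    have hn := integrable_rpow_mul_exp_neg_mul_sq (b := 1) one_pos (s := n)
      (by linarith [n.cast_nonneg (α := ℝ)])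
    simpa only [eval_monomial, Real.rpow_natCast, mul_assoc] using hn.const_mul a

theorem integrable_eval_div_pow_mul_w {t : ℝ} (ht : 0 < t) (j : ℕ) (p : ℝ[X]) :
    Integrable fun x : ℝ => p.eval x / x ^ (2 * j) * w t x := by
  refine ((integrable_eval_mul_gaussian p).const_mul (j.factorial / t ^ j)).mono
    ((p.continuous.measurable.div (by fun_prop)).mul (measurable_w t)).aestronglyMeasurable
    (Filter.Eventually.of_forall fun x => ?_)
  have hpow : 0 ≤ x ^ (2 * j) := (even_two_mul j).pow_nonneg x
  have hb := mul_le_mul_of_nonneg_left (inv_pow_mul_w_le ht j x) (abs_nonneg (p.eval x))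
  have hc : (0 : ℝ) ≤ j.factorial / t ^ j := by positivity
  simp only [Real.norm_eq_abs, abs_mul, abs_div, abs_of_nonneg hpow, abs_of_nonneg (w_nonneg t x),
    Real.abs_exp] at hb ⊢
  rw [← abs_div, abs_of_nonneg hc]
  calc _ = |p.eval x| * ((x ^ (2 * j))⁻¹ * w t x) := by ring
    _ ≤ _ := hb
    _ = _ := by ring

theorem integrable_eval_mul_w {t : ℝ} (ht : 0 < t) (p : ℝ[X]) :
    Integrable fun x : ℝ => p.eval x * w t x := by
  simpa using integrable_eval_div_pow_mul_w ht 0 p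

theorem integrable_eval_div_cube_mul_w {t : ℝ} (ht : 0 < t) (p : ℝ[X]) :
    Integrable fun x : ℝ => p.eval x / x ^ 3 * w t x := by
  convert integrable_eval_div_pow_mul_w ht 2 (p * X) using 2 with x
  by_cases hx : x = 0
  · simp [hx]
  · simp only [eval_mul, eval_X]
    field_simp
    ring

/-- The moment functional `p ↦ ∫ p(x) w(x,t) dx` on real polynomials. -/
noncomputable def moment {t : ℝ} (ht : 0 < t) : ℝ[X] →ₗ[ℝ] ℝ where
  toFun p := ∫ x : ℝ, p.eval x * w t x
  map_add' p q := by
    simp only [eval_add, add_mul]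
    exact integral_add (integrable_eval_mul_w ht p) (integrable_eval_mul_w ht q)
  map_smul' a p := by
    simp only [eval_smul, smul_eq_mul, mul_assoc, integral_const_mul, RingHom.id_apply]

theorem moment_apply {t : ℝ} (ht : 0 < t) (p : ℝ[X]) :
    moment ht p = ∫ x : ℝ, p.eval x * w t x := rfl

theorem moment_comp_neg_X {t : ℝ} (ht : 0 < t) (p : ℝ[X]) :
    moment ht (p.comp (-X)) = moment ht p := by
  rw [moment_apply, moment_apply, ← integral_neg_eq_self]
  simp [w_neg]

section OrthogonalPolynomials

variable {L : ℝ[X] →ₗ[ℝ] ℝ} {P : ℕ → ℝ[X]}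

theorem degree_sub_leadingCoeff_smul_lt (hmonic : ∀ n, (P n).Monic)
    (hdeg : ∀ n, (P n).natDegree = n) {q : ℝ[X]} (hq : q ≠ 0) :
    (q - q.leadingCoeff • P q.natDegree).degree < q.natDegree := by
  have hlc : q.leadingCoeff ≠ 0 := leadingCoeff_ne_zero.mpr hq
  have hd : (q.leadingCoeff • P q.natDegree).degree = q.degree := by
    rw [smul_eq_C_mul, degree_C_mul hlc, degree_eq_natDegree (hmonic _).ne_zero, hdeg,
      degree_eq_natDegree hq]
  rw [← degree_eq_natDegree hq]
  refine degree_sub_lt_left hd.symm hq ?_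
  rw [smul_eq_C_mul, leadingCoeff_mul, (hmonic _).leadingCoeff, leadingCoeff_C, mul_one]

theorem apply_mul_eq_zero_of_degree_lt (hmonic : ∀ n, (P n).Monic)
    (hdeg : ∀ n, (P n).natDegree = n) (horth : ∀ m n, m ≠ n → L (P m * P n) = 0) (m : ℕ)
    (q : ℝ[X]) (hq : q.degree < m) : L (P m * q) = 0 := by
  induction hk : q.natDegree using Nat.strong_induction_on generalizing q with
  | _ k ih =>
    by_cases hq0 : q = 0
    · simp [hq0]
    have hlt := degree_sub_leadingCoeff_smul_lt hmonic hdeg hq0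
    have hkm : q.natDegree < m := by
      rw [degree_eq_natDegree hq0] at hq
      exact_mod_cast hq
    set e := q - q.leadingCoeff • P q.natDegree with he
    have hsplit : q = e + q.leadingCoeff • P q.natDegree := by rw [he]; ring
    have hLe : L (P m * e) = 0 := by
      by_cases he0 : e = 0
      · simp [he0]
      · exact ih e.natDegree (hk ▸ (natDegree_lt_iff_degree_lt he0).mpr hlt) e
          (hlt.trans (by exact_mod_cast hkm)) rfl
    rw [hsplit, mul_add, map_add, hLe, mul_smul_comm, map_smul, horth m _ hkm.ne', smul_zero,
      add_zero]

theorem eq_zero_of_apply_mul_eq_zero (hmonic : ∀ n, (P n).Monic)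
    (hdeg : ∀ n, (P n).natDegree = n) (horth : ∀ m n, m ≠ n → L (P m * P n) = 0)
    (hne : ∀ n, L (P n * P n) ≠ 0) {m : ℕ} {q : ℝ[X]} (hq : q.degree < m)
    (hL : ∀ k < m, L (P k * q) = 0) : q = 0 := by
  by_contra hq0
  have hkm : q.natDegree < m := (natDegree_lt_iff_degree_lt hq0).mpr hq
  have h1 := apply_mul_eq_zero_of_degree_lt hmonic hdeg horth _ _
    (degree_sub_leadingCoeff_smul_lt hmonic hdeg hq0)
  rw [mul_sub, map_sub, hL _ hkm, mul_smul_comm, map_smul, zero_sub, neg_eq_zero,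
    smul_eq_mul] at h1
  exact (mul_ne_zero (leadingCoeff_ne_zero.mpr hq0) (hne _)) h1

theorem comp_neg_X_eq (hmonic : ∀ n, (P n).Monic)
    (hdeg : ∀ n, (P n).natDegree = n) (horth : ∀ m n, m ≠ n → L (P m * P n) = 0)
    (hne : ∀ n, L (P n * P n) ≠ 0) (hsymm : ∀ p : ℝ[X], L (p.comp (-X)) = L p) (n : ℕ) :
    (P n).comp (-X) = (-1 : ℝ) ^ n • P n := by
  have hPd : (P n).degree = n := by rw [degree_eq_natDegree (hmonic n).ne_zero, hdeg]
  have hc : ((-1 : ℝ) ^ n) ≠ 0 := pow_ne_zero _ (by norm_num)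
  refine sub_eq_zero.mp (eq_zero_of_apply_mul_eq_zero hmonic hdeg horth hne (m := n) ?_ ?_)
  · rw [← hPd, ← degree_comp_neg_X (p := P n)]
    refine degree_sub_lt_left ?_ ?_ ?_
    · rw [degree_comp_neg_X, smul_eq_C_mul, degree_C_mul hc]
    · intro h
      have := degree_comp_neg_X (p := P n)
      rw [h, hPd] at this
      simp at this
    · rw [leadingCoeff_comp (by simp), smul_eq_C_mul, leadingCoeff_mul, leadingCoeff_C,
        (hmonic n).leadingCoeff, hdeg]
      simp
  · intro k hk
    have h1 : L (P k * (P n).comp (-X)) = 0 := by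
      have : P k * (P n).comp (-X) = (P n * (P k).comp (-X)).comp (-X) := by
        simp [mul_comp, comp_assoc, mul_comm]
      rw [this, hsymm]
      apply apply_mul_eq_zero_of_degree_lt hmonic hdeg horth
      rw [degree_comp_neg_X, degree_eq_natDegree (hmonic k).ne_zero, hdeg]
      exact_mod_cast hk
    rw [mul_sub, map_sub, h1, mul_smul_comm, map_smul, horth k n hk.ne, smul_zero, sub_zero]

theorem apply_mul_X_mul_self (hmonic : ∀ n, (P n).Monic)
    (hdeg : ∀ n, (P n).natDegree = n) (horth : ∀ m n, m ≠ n → L (P m * P n) = 0)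
    (hne : ∀ n, L (P n * P n) ≠ 0) (hsymm : ∀ p : ℝ[X], L (p.comp (-X)) = L p) (n : ℕ) :
    L (P n * (X * P n)) = 0 := by
  have h1 := hsymm (P n * (X * P n))
  have h2 : (P n * (X * P n)).comp (-X) = -(P n * (X * P n)) := by
    simp only [mul_comp, X_comp, comp_neg_X_eq hmonic hdeg horth hne hsymm n, smul_mul_assoc,
      mul_smul_comm, smul_smul, ← mul_pow]
    simp
  rw [h2, map_neg] at h1
  linarith

theorem degree_X_mul_sub_lt (hmonic : ∀ n, (P n).Monic) (hdeg : ∀ n, (P n).natDegree = n)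
    (n : ℕ) : (X * P n - P (n + 1)).degree < ((n + 1 : ℕ) : WithBot ℕ) := by
  have h1 : (X * P n).degree = ((n + 1 : ℕ) : WithBot ℕ) := by
    rw [degree_mul, degree_X, degree_eq_natDegree (hmonic n).ne_zero, hdeg, add_comm]
    rfl
  rw [← h1]
  refine degree_sub_lt_left ?_ (mul_ne_zero X_ne_zero (hmonic n).ne_zero) ?_
  · rw [h1, degree_eq_natDegree (hmonic _).ne_zero, hdeg]
  · rw [(monic_X.mul (hmonic n)).leadingCoeff, (hmonic _).leadingCoeff]

theorem X_mul_zero_eq (hmonic : ∀ n, (P n).Monic)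
    (hdeg : ∀ n, (P n).natDegree = n) (horth : ∀ m n, m ≠ n → L (P m * P n) = 0)
    (hne : ∀ n, L (P n * P n) ≠ 0) (hsymm : ∀ p : ℝ[X], L (p.comp (-X)) = L p) :
    X * P 0 = P 1 := by
  refine sub_eq_zero.mp (eq_zero_of_apply_mul_eq_zero hmonic hdeg horth hne
    (degree_X_mul_sub_lt hmonic hdeg 0) fun k hk => ?_)
  obtain rfl : k = 0 := by omega
  rw [mul_sub, map_sub, apply_mul_X_mul_self hmonic hdeg horth hne hsymm, horth _ _ (by simp),
    sub_zero]

/-- Three-term recurrence for monic orthogonal polynomials of a symmetric functional. -/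
theorem X_mul_succ_eq (hmonic : ∀ n, (P n).Monic)
    (hdeg : ∀ n, (P n).natDegree = n) (horth : ∀ m n, m ≠ n → L (P m * P n) = 0)
    (hne : ∀ n, L (P n * P n) ≠ 0) (hsymm : ∀ p : ℝ[X], L (p.comp (-X)) = L p) (n : ℕ) :
    X * P (n + 1) =
      P (n + 2) + (L (P (n + 1) * P (n + 1)) / L (P n * P n)) • P n := by
  have hd : ∀ k, (P k).degree = k := fun k => by
    rw [degree_eq_natDegree (hmonic k).ne_zero, hdeg]
  rw [← sub_eq_zero, ← sub_sub]
  refine eq_zero_of_apply_mul_eq_zero hmonic hdeg horth hne (m := n + 2) ?_ fun k hk => ?_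
  · refine (degree_sub_le _ _).trans_lt (max_lt (degree_X_mul_sub_lt hmonic hdeg (n + 1)) ?_)
    refine (degree_smul_le _ _).trans_lt ?_
    rw [hd]
    exact_mod_cast (by omega : n < n + 2)
  · rw [mul_sub, mul_sub, map_sub, map_sub, horth k (n + 2) hk.ne, sub_zero, mul_smul_comm,
      map_smul, smul_eq_mul]
    rcases (by omega : k = n + 1 ∨ k = n ∨ k < n) with rfl | rfl | hkn
    · rw [apply_mul_X_mul_self hmonic hdeg horth hne hsymm, horth (n + 1) n (by omega)]
      simp
    · rw [div_mul_cancel₀ _ (hne k)]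
      have h1 := apply_mul_eq_zero_of_degree_lt hmonic hdeg horth _ _
        (degree_X_mul_sub_lt hmonic hdeg k)
      rw [mul_sub, map_sub] at h1
      rw [← h1]
      congr 2
      ring
    · rw [horth k n hkn.ne, mul_zero, sub_zero, mul_left_comm, ← mul_assoc, mul_comm]
      apply apply_mul_eq_zero_of_degree_lt hmonic hdeg horth
      rw [degree_mul, degree_X, hd]
      exact_mod_cast (by omega : 1 + k < n + 1)

end OrthogonalPolynomials

theorem statement3
    (t : ℝ) (ht : 0 < t)
    (P : ℕ → Polynomial ℝ)
    (hmonic : ∀ n, (P n).Monic)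
    (hdeg : ∀ n, (P n).natDegree = n)
    (horth : ∀ m n : ℕ, m ≠ n → ∫ x : ℝ, (P m).eval x * (P n).eval x * w t x = 0)
    (h : ℕ → ℝ)
    (hh : ∀ n, h n = ∫ x : ℝ, ((P n).eval x) ^ 2 * w t x)
    (hhpos : ∀ n, 0 < h n)
    (R : ℕ → ℝ)
    (hR : ∀ n, R n = 2 * t / h n * ∫ y : ℝ, ((P n).eval y) ^ 2 / y ^ 2 * w t y)
    (r : ℕ → ℝ)
    (hr : ∀ n, 1 ≤ n → r n = 2 * t / h (n - 1) *
      ∫ y : ℝ, (P n).eval y * (P (n - 1)).eval y / y ^ 3 * w t y)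
    (hr0 : r 0 = 0)
    (n : ℕ) :
    R n = r (n + 1) + r n := by
  have horth' : ∀ m n, m ≠ n → moment ht (P m * P n) = 0 := fun m n hmn => by
    simpa only [moment_apply, eval_mul] using horth m n hmn
  have hL : ∀ n, moment ht (P n * P n) = h n := fun n => by
    simp only [hh, moment_apply, eval_mul, sq]
  have hne : ∀ n, moment ht (P n * P n) ≠ 0 := fun n => by
    rw [hL]
    exact (hhpos n).ne'
  have hsymm := moment_comp_neg_X ht
  have hsq : ∀ n (y : ℝ), (P n).eval y ^ 2 / y ^ 2 =
      (P n).eval y * (X * P n).eval y / y ^ 3 := fun n y => by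
    by_cases hy : y = 0
    · simp [hy]
    · simp only [eval_mul, eval_X]
      field_simp
  rw [hR, hr (n + 1) (by omega), Nat.add_sub_cancel]
  simp only [hsq]
  cases n with
  | zero =>
    rw [hr0, add_zero, X_mul_zero_eq hmonic hdeg horth' hne hsymm]
    simp only [mul_comm, zero_add]
  | succ n =>
    rw [hr (n + 1) (by omega), Nat.add_sub_cancel, X_mul_succ_eq hmonic hdeg horth' hne hsymm n,
      hL, hL]
    have hsplit : ∀ y : ℝ, (P (n + 1)).eval y *
        (P (n + 2) + (h (n + 1) / h n) • P n).eval y / y ^ 3 * w t y =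
        (P (n + 2) * P (n + 1)).eval y / y ^ 3 * w t y +
          h (n + 1) / h n * ((P (n + 1) * P n).eval y / y ^ 3 * w t y) := fun y => by
      simp only [eval_add, eval_mul, eval_smul, smul_eq_mul]
      ring
    simp only [hsplit]
    rw [integral_add (integrable_eval_div_cube_mul_w ht _)
      ((integrable_eval_div_cube_mul_w ht _).const_mul _), integral_const_mul]
    simp only [eval_mul]
    have h0 := (hhpos n).ne'
    have h1 := (hhpos (n + 1)).ne'
    field_simp
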